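/- Let ψ : ℝ → ℝ be continuous and 1-periodic with −ψ(x) = ψ(x + 1/2) for all x (a supersymmetric potential), and let ω ≠ 0. Then J(ψ,ω) = 0, and consequently A(ω,ψ) + A(−ω,ψ) = 0, i.e. the adiabatic drift velocity v_{∞∞} vanishes. -/

import Mathlib

open MeasureTheory

/-- `α(ω) = e^ω − 1`. -/
noncomputable def ratchetAlpha (ω : ℝ) : ℝ := Real.exp ω - 1

/-- `β₊(ω,ψ) = ∫₀¹ e^{ωx + ψ(x)} dx`. -/
noncomputable def ratchetBetaPlus (ω : ℝ) (ψ : ℝ → ℝ) : ℝ :=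
  ∫ x in (0:ℝ)..1, Real.exp (ω * x + ψ x)

/-- `β₋(ω,ψ) = ∫₀¹ e^{−ωx − ψ(x)} dx`. -/
noncomputable def ratchetBetaMinus (ω : ℝ) (ψ : ℝ → ℝ) : ℝ :=
  ∫ x in (0:ℝ)..1, Real.exp (-(ω * x) - ψ x)

/-- `β(ω,ψ) = ∫₀¹ ∫₀^x e^{ωy + ψ(y) − ωx − ψ(x)} dy dx`. -/
noncomputable def ratchetBeta (ω : ℝ) (ψ : ℝ → ℝ) : ℝ :=
  ∫ x in (0:ℝ)..1, ∫ y in (0:ℝ)..x, Real.exp (ω * y + ψ y - ω * x - ψ x)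

/-- `A(ω,ψ) = α(ω) / (α(ω) β(ω,ψ) + β₊(ω,ψ) β₋(ω,ψ))`. -/
noncomputable def ratchetA (ω : ℝ) (ψ : ℝ → ℝ) : ℝ :=
  ratchetAlpha ω /
    (ratchetAlpha ω * ratchetBeta ω ψ + ratchetBetaPlus ω ψ * ratchetBetaMinus ω ψ)

/-- `B(ω,ψ) = β₊(ω,ψ) / (α(ω) β(ω,ψ) + β₊(ω,ψ) β₋(ω,ψ))`. -/
noncomputable def ratchetB (ω : ℝ) (ψ : ℝ → ℝ) : ℝ :=
  ratchetBetaPlus ω ψ /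
    (ratchetAlpha ω * ratchetBeta ω ψ + ratchetBetaPlus ω ψ * ratchetBetaMinus ω ψ)

/-- `J(ψ,ω) = (2/sinh(ω/2)) ∫₀¹ ∫₀^x sinh(ψ(x) − ψ(y)) sinh(ω(x − y − 1/2)) dy dx`. -/
noncomputable def ratchetJ (ψ : ℝ → ℝ) (ω : ℝ) : ℝ :=
  (2 / Real.sinh (ω / 2)) *
    ∫ x in (0:ℝ)..1, ∫ y in (0:ℝ)..x,
      Real.sinh (ψ x - ψ y) * Real.sinh (ω * (x - y - 1 / 2))


/-- The denominator `α β + β₊ β₋`. -/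
noncomputable def ratchetD (ω : ℝ) (ψ : ℝ → ℝ) : ℝ :=
  ratchetAlpha ω * ratchetBeta ω ψ + ratchetBetaPlus ω ψ * ratchetBetaMinus ω ψ

/-- The correlation kernel. -/
noncomputable def ratchetK (ψ : ℝ → ℝ) (u : ℝ) : ℝ :=
  ∫ x in (0:ℝ)..1, Real.exp (ψ (x + u) - ψ x)

lemma ratchetBeta_eq (ω : ℝ) (ψ : ℝ → ℝ) :
    ratchetBeta ω ψ = ∫ x in (0:ℝ)..1, Real.exp (-(ω * x) - ψ x) *
      ∫ y in (0:ℝ)..x, Real.exp (ω * y + ψ y) := by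
  unfold ratchetBeta
  congr 1
  ext x
  rw [← intervalIntegral.integral_const_mul]
  congr 1
  ext y
  rw [← Real.exp_add]
  congr 1
  ring

lemma ratchet_cont_inner (ω : ℝ) (ψ : ℝ → ℝ) (hc : Continuous ψ) :
    Continuous (fun x : ℝ => ∫ y in (0:ℝ)..x, Real.exp (ω * y + ψ y)) := by
  apply intervalIntegral.continuous_primitive
  intro a b
  apply Continuous.intervalIntegrable
  fun_prop

lemma ratchetD_eq (ω : ℝ) (ψ : ℝ → ℝ) (hc : Continuous ψ) (hper : Function.Periodic ψ 1) :
    ratchetD ω ψ = ∫ u in (0:ℝ)..1, Real.exp (ω * u) * ratchetK ψ u := by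
  have hci := ratchet_cont_inner ω ψ hc
  have hF : Continuous (fun y : ℝ => Real.exp (ω * y + ψ y)) := by fun_prop
  have hI : ∀ a b : ℝ, IntervalIntegrable (fun y : ℝ => Real.exp (ω * y + ψ y)) volume a b :=
    fun a b => hF.intervalIntegrable a b
  have h1 : ratchetD ω ψ = ∫ x in (0:ℝ)..1, ∫ u in (0:ℝ)..1,
      Real.exp (ω * u) * Real.exp (ψ (x + u) - ψ x) := by
    unfold ratchetD
    rw [ratchetBeta_eq]
    unfold ratchetBetaMinus
    rw [← intervalIntegral.integral_const_mul, ← intervalIntegral.integral_const_mul,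
      ← intervalIntegral.integral_add]
    · congr 1
      ext x
      have e1 : (∫ y in (0:ℝ)..x, Real.exp (ω * y + ψ y)) * Real.exp ω
          = ∫ y in (1:ℝ)..(x+1), Real.exp (ω * y + ψ y) := by
        have := intervalIntegral.integral_comp_add_right (a := 0) (b := x)
          (fun y => Real.exp (ω * y + ψ y)) 1
        rw [zero_add] at this
        rw [← this, ← intervalIntegral.integral_mul_const]
        congr 1
        ext y
        rw [← Real.exp_add, hper y]
        congr 1
        ring
      have e2 : (∫ y in (0:ℝ)..x, Real.exp (ω * y + ψ y))
          + (∫ y in x..1, Real.exp (ω * y + ψ y)) = ratchetBetaPlus ω ψ :=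
        intervalIntegral.integral_add_adjacent_intervals (hI _ _) (hI _ _)
      have e3 : (∫ y in x..1, Real.exp (ω * y + ψ y))
          + (∫ y in (1:ℝ)..(x+1), Real.exp (ω * y + ψ y))
          = ∫ y in x..(x+1), Real.exp (ω * y + ψ y) :=
        intervalIntegral.integral_add_adjacent_intervals (hI _ _) (hI _ _)
      have e4 : (∫ u in (0:ℝ)..1, Real.exp (ω * u) * Real.exp (ψ (x + u) - ψ x))
          = Real.exp (-(ω * x) - ψ x) * ∫ y in x..(x+1), Real.exp (ω * y + ψ y) := by
        have := intervalIntegral.integral_comp_add_left (a := 0) (b := 1)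
          (fun y => Real.exp (ω * y + ψ y)) x
        rw [add_zero] at this
        rw [← this, ← intervalIntegral.integral_const_mul]
        congr 1
        ext y
        rw [← Real.exp_add, ← Real.exp_add]
        congr 1
        ring
      rw [e4, ← e3, ← e1, ← e2]
      unfold ratchetAlpha
      ring
    · apply Continuous.intervalIntegrable
      fun_prop
    · apply Continuous.intervalIntegrable
      fun_prop
  rw [h1, MeasureTheory.intervalIntegral_intervalIntegral_swap]
  · congr 1
    ext u
    unfold ratchetK
    rw [← intervalIntegral.integral_const_mul]
  · have hcc : Continuous (Function.uncurry
        (fun x u : ℝ => Real.exp (ω * u) * Real.exp (ψ (x + u) - ψ x))) := by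
      unfold Function.uncurry
      fun_prop
    apply (hcc.continuousOn.integrableOn_compact
      (isCompact_uIcc.prod isCompact_uIcc)).mono_set
      (Set.prod_mono Set.uIoc_subset_uIcc Set.uIoc_subset_uIcc)

lemma ratchetK_neg (ψ : ℝ → ℝ) (hper : Function.Periodic ψ 1)
    (hsusy : ∀ x : ℝ, -ψ x = ψ (x + 1 / 2)) (u : ℝ) :
    ratchetK (fun x => -ψ x) u = ratchetK ψ u := by
  have hp : Function.Periodic (fun x => Real.exp (ψ (x + u) - ψ x)) 1 := by
    intro x
    have := hper (x + u)
    simp only [hper x, show x + 1 + u = x + u + 1 by ring, this]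
  have h := hp.intervalIntegral_add_eq (1/2) 0
  have h2 := intervalIntegral.integral_comp_add_right (a := 0) (b := 1)
    (fun x => Real.exp (ψ (x + u) - ψ x)) (1/2)
  unfold ratchetK
  rw [zero_add, add_comm (1:ℝ) (1/2), h, zero_add] at h2
  rw [← h2]
  congr 1
  ext x
  beta_reduce
  rw [hsusy, hsusy]
  congr 3
  ring

lemma ratchetK_one_sub (ψ : ℝ → ℝ) (hper : Function.Periodic ψ 1) (u : ℝ) :
    ratchetK ψ (1 - u) = ratchetK (fun x => -ψ x) u := by
  have hp : Function.Periodic (fun x => Real.exp (ψ (x + (1 - u)) - ψ x)) 1 := by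
    intro x
    have := hper (x + (1 - u))
    simp only [hper x, show x + 1 + (1 - u) = x + (1 - u) + 1 by ring, this]
  have h := hp.intervalIntegral_add_eq u 0
  have h2 := intervalIntegral.integral_comp_add_right (a := 0) (b := 1)
    (fun x => Real.exp (ψ (x + (1 - u)) - ψ x)) u
  unfold ratchetK
  rw [zero_add, add_comm (1:ℝ) u, h, zero_add] at h2
  rw [← h2]
  congr 1
  ext x
  rw [show x + u + (1 - u) = x + 1 by ring, hper x]
  congr 1
  ring

lemma ratchetD_neg_psi (ω : ℝ) (ψ : ℝ → ℝ) (hc : Continuous ψ) (hper : Function.Periodic ψ 1)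
    (hsusy : ∀ x : ℝ, -ψ x = ψ (x + 1 / 2)) :
    ratchetD ω (fun x => -ψ x) = ratchetD ω ψ := by
  rw [ratchetD_eq ω ψ hc hper, ratchetD_eq ω (fun x => -ψ x) hc.neg (fun x => by simp only [hper x])]
  simp only [ratchetK_neg ψ hper hsusy]

lemma ratchetD_neg_omega (ω : ℝ) (ψ : ℝ → ℝ) (hc : Continuous ψ) (hper : Function.Periodic ψ 1)
    (hsusy : ∀ x : ℝ, -ψ x = ψ (x + 1 / 2)) :
    ratchetD (-ω) ψ = Real.exp (-ω) * ratchetD ω ψ := by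
  rw [ratchetD_eq ω ψ hc hper, ratchetD_eq (-ω) ψ hc hper]
  have h := intervalIntegral.integral_comp_sub_left (a := 0) (b := 1)
    (fun u => Real.exp (-ω * u) * ratchetK ψ u) 1
  rw [sub_self, sub_zero] at h
  rw [← h, ← intervalIntegral.integral_const_mul]
  congr 1
  ext u
  rw [ratchetK_one_sub ψ hper, ratchetK_neg ψ hper hsusy, ← mul_assoc, ← Real.exp_add]
  congr 2
  ring

lemma ratchetBP_neg (ω : ℝ) (ψ : ℝ → ℝ) :
    ratchetBetaPlus (-ω) (fun x => -ψ x) = ratchetBetaMinus ω ψ := by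
  unfold ratchetBetaPlus ratchetBetaMinus
  congr 1
  ext x
  congr 1
  ring

lemma ratchetBM_neg (ω : ℝ) (ψ : ℝ → ℝ) :
    ratchetBetaMinus (-ω) (fun x => -ψ x) = ratchetBetaPlus ω ψ := by
  unfold ratchetBetaPlus ratchetBetaMinus
  congr 1
  ext x
  congr 1
  ring

lemma ratchetAlpha_ne (ω : ℝ) (hω : ω ≠ 0) : ratchetAlpha ω ≠ 0 := by
  unfold ratchetAlpha
  rw [sub_ne_zero]
  simpa using hω

lemma ratchetAlpha_neg (ω : ℝ) : ratchetAlpha (-ω) = -(Real.exp (-ω) * ratchetAlpha ω) := by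
  unfold ratchetAlpha
  rw [mul_sub, ← Real.exp_add]
  simp

lemma ratchetJ_integral (ω : ℝ) (ψ : ℝ → ℝ) (hc : Continuous ψ) :
    (∫ x in (0:ℝ)..1, ∫ y in (0:ℝ)..x,
      Real.sinh (ψ x - ψ y) * Real.sinh (ω * (x - y - 1 / 2))) =
    (Real.exp (-ω / 2) * ratchetBeta (-ω) (fun x => -ψ x)
      - Real.exp (ω / 2) * ratchetBeta ω (fun x => -ψ x)
      - Real.exp (-ω / 2) * ratchetBeta (-ω) ψ
      + Real.exp (ω / 2) * ratchetBeta ω ψ) / 4 := by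
  have key : ∀ (w : ℝ) (f : ℝ → ℝ), Continuous f →
      IntervalIntegrable (fun x : ℝ => ∫ y in (0:ℝ)..x, Real.exp (w * y + f y - w * x - f x))
        volume 0 1 := by
    intro w f hf
    have : (fun x : ℝ => ∫ y in (0:ℝ)..x, Real.exp (w * y + f y - w * x - f x)) =
        fun x => Real.exp (-(w * x) - f x) * ∫ y in (0:ℝ)..x, Real.exp (w * y + f y) := by
      ext x
      rw [← intervalIntegral.integral_const_mul]
      congr 1
      ext y
      rw [← Real.exp_add]
      congr 1
      ring
    rw [this]
    have := ratchet_cont_inner w f hf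
    apply Continuous.intervalIntegrable
    fun_prop
  have hn : Continuous (fun x => -ψ x) := hc.neg
  have k1 := (key (-ω) _ hn).const_mul (Real.exp (-ω / 2))
  have k2 := (key ω _ hn).const_mul (Real.exp (ω / 2))
  have k3 := (key (-ω) _ hc).const_mul (Real.exp (-ω / 2))
  have k4 := (key ω _ hc).const_mul (Real.exp (ω / 2))
  unfold ratchetBeta
  simp only [← intervalIntegral.integral_const_mul] at k1 k2 k3 k4 ⊢
  rw [← intervalIntegral.integral_sub k1 k2, ← intervalIntegral.integral_sub (k1.sub k2) k3,
    ← intervalIntegral.integral_add ((k1.sub k2).sub k3) k4, ← intervalIntegral.integral_div]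
  congr 1
  ext x
  rw [← intervalIntegral.integral_sub, ← intervalIntegral.integral_sub,
    ← intervalIntegral.integral_add, ← intervalIntegral.integral_div]
  · congr 1
    ext y
    simp only [← Real.exp_add]
    rw [Real.sinh_eq, Real.sinh_eq]
    rw [show -ω / 2 + (-ω * y + -ψ y - -ω * x - -ψ x) = (ψ x - ψ y) + ω * (x - y - 1 / 2) by ring,
      show ω / 2 + (ω * y + -ψ y - ω * x - -ψ x) = (ψ x - ψ y) + -(ω * (x - y - 1 / 2)) by ring,
      show -ω / 2 + (-ω * y + ψ y - -ω * x - ψ x) = -(ψ x - ψ y) + ω * (x - y - 1 / 2) by ring,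
      show ω / 2 + (ω * y + ψ y - ω * x - ψ x) = -(ψ x - ψ y) + -(ω * (x - y - 1 / 2)) by ring]
    simp only [Real.exp_add]
    ring
  all_goals
    apply Continuous.intervalIntegrable
    fun_prop

/-- Supersymmetric potentials (`−ψ(x) = ψ(x + 1/2)`) produce no adiabatic transport:
`J(ψ,ω) = 0` and `A(ω,ψ) + A(−ω,ψ) = 0`. -/
theorem supersymmetric_no_transport
    (ψ : ℝ → ℝ) (hc : Continuous ψ) (hper : Function.Periodic ψ 1)
    (hsusy : ∀ x : ℝ, -ψ x = ψ (x + 1 / 2))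
    (ω : ℝ) (hω : ω ≠ 0) :
    ratchetJ ψ ω = 0 ∧ ratchetA ω ψ + ratchetA (-ω) ψ = 0 := by
  have hp := ratchetAlpha_ne ω hω
  have hD := ratchetD_neg_omega ω ψ hc hper hsusy
  have hE := Real.exp_ne_zero (-ω)
  constructor
  · unfold ratchetJ
    rw [ratchetJ_integral ω ψ hc]
    have d1 := ratchetD_neg_psi ω ψ hc hper hsusy
    have d2 := ratchetD_neg_psi (-ω) ψ hc hper hsusy
    have p1 := ratchetBP_neg ω ψ
    have p2 := ratchetBM_neg ω ψ
    have p3 := ratchetBP_neg (-ω) ψ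
    have p4 := ratchetBM_neg (-ω) ψ
    rw [neg_neg] at p3 p4
    unfold ratchetD at d1 d2
    rw [p1, p2] at d2
    rw [p3, p4] at d1
    rw [ratchetAlpha_neg] at d2
    have x1 : Real.exp (-ω) * Real.exp (ω / 2) = Real.exp (-ω / 2) := by
      rw [← Real.exp_add]
      congr 1
      ring
    have hz : ratchetAlpha ω * (Real.exp (-ω / 2) * ratchetBeta (-ω) (fun x => -ψ x)
      - Real.exp (ω / 2) * ratchetBeta ω (fun x => -ψ x)
      - Real.exp (-ω / 2) * ratchetBeta (-ω) ψ
      + Real.exp (ω / 2) * ratchetBeta ω ψ) = 0 := by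
      rw [← x1]
      linear_combination (-Real.exp (ω / 2)) * d1 - Real.exp (ω / 2) * d2
    rw [(mul_eq_zero.mp hz).resolve_left hp]
    simp
  · change ratchetAlpha ω / ratchetD ω ψ + ratchetAlpha (-ω) / ratchetD (-ω) ψ = 0
    rw [hD, ratchetAlpha_neg, neg_div, mul_div_mul_left _ _ hE]
    ring
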